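/- arXiv:2411.01370 — 2 statements merged into one kernel-verified Lean document; each statement's English description precedes it below -/
import Mathlib

section
/- (Theorem 4: approximation ratio.) In the concrete capacity model, assume in addition D₁ := ∑_{j=1}^N d_{r,j} > 0 and f_{s,i} > 0 for every stage s and facility i, set h_max := max_i h_{1,i}, and suppose the feasible set is nonempty, so z^MS (the infimum of F over feasible tuples) is a positive real number. If v is the objective value F of any feasible tuple satisfying v − z^MS ≤ ∑_{s=1}^T ∑_{i=1}^M f_{s,i} (the guarantee established for the output of the approximation algorithm), then v / z^MS ≤ 1 + ( M · ∑_{s=1}^T max_i f_{s,i} ) / ( ⌈D₁ / h_max⌉ · ∑_{s=1}^T min_i f_{s,i} + ∑_{s=1}^T ( min_{i,j} c_{s,ij} ) · min_{n∈𝒯_s} ∑_{j=1}^N d_{n,j} ). -/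
open Finset

/-- A scenario tree with `T` stages: a finite nonempty set of nodes with a root,
a parent map fixing the root, a stage map decreasing by one along the parent map,
such that every node reaches the root by iterating the parent map, and every
non-leaf node has a child. -/
structure STree (T : ℕ) : Type 1 where
  Node : Type
  fin : Fintype Node
  deceq : DecidableEq Node
  root : Node
  parent : Node → Node
  stage : Node → ℕ
  hT : 1 ≤ T
  parent_root : parent root = root
  stage_root : stage root = 1
  stage_ge : ∀ n, 1 ≤ stage n
  stage_le : ∀ n, stage n ≤ T
  stage_parent : ∀ n, n ≠ root → stage (parent n) = stage n - 1
  reaches_root : ∀ n, ∃ k, parent^[k] n = root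
  children_ne : ∀ n, stage n ≠ T → ∃ m, m ≠ root ∧ parent m = n

attribute [instance] STree.fin STree.deceq

namespace STree

variable {T : ℕ} (S : STree T)

/-- The path set `𝒫(n) = {aᵏ(n) : k ≥ 0}` of a node. -/
def path (n : S.Node) : Finset S.Node :=
  (Finset.range T).image fun k => S.parent^[k] n

theorem path_nonempty (n : S.Node) : (S.path n).Nonempty :=
  ⟨n, Finset.mem_image.mpr ⟨0, Finset.mem_range.mpr S.hT, rfl⟩⟩

/-- The children `𝒞(n)` of a node. -/
def children (n : S.Node) : Finset S.Node :=
  Finset.univ.filter fun m => m ≠ S.root ∧ S.parent m = n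

theorem children_nonempty {n : S.Node} (h : S.stage n ≠ T) : (S.children n).Nonempty := by
  obtain ⟨m, h1, h2⟩ := S.children_ne n h
  exact ⟨m, Finset.mem_filter.mpr ⟨Finset.mem_univ m, h1, h2⟩⟩

/-- The set `𝒯ₛ` of stage-`s` nodes. -/
def stageNodes (s : ℕ) : Finset S.Node :=
  Finset.univ.filter fun n => S.stage n = s

theorem stageNodes_self_nonempty (n : S.Node) : (S.stageNodes (S.stage n)).Nonempty :=
  ⟨n, Finset.mem_filter.mpr ⟨Finset.mem_univ n, rfl⟩⟩

end STree
namespace STree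

variable {T : ℕ} (S : STree T)

theorem stageNodes_nonempty : ∀ s : ℕ, 1 ≤ s → s ≤ T → (S.stageNodes s).Nonempty := by
  intro s
  induction s with
  | zero => intro h _; omega
  | succ k ih =>
    intro _ h2
    by_cases hk : k = 0
    · subst hk
      refine ⟨S.root, ?_⟩
      have hr := S.stage_root
      simp only [stageNodes, Finset.mem_filter, Finset.mem_univ, true_and]
      omega
    · obtain ⟨n, hn⟩ := ih (by omega) (by omega)
      simp only [stageNodes, Finset.mem_filter, Finset.mem_univ, true_and] at hn
      have hnT : S.stage n ≠ T := by omega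
      obtain ⟨m, hm1, hm2⟩ := S.children_ne n hnT
      have h3 := S.stage_parent m hm1
      have h4 := S.stage_ge m
      rw [hm2] at h3
      refine ⟨m, ?_⟩
      simp only [stageNodes, Finset.mem_filter, Finset.mem_univ, true_and]
      omega

end STree

section ConcreteModel

variable {T M N : ℕ}

/-- Stage cost `g_n` of node `n` in the concrete capacity planning model. -/
noncomputable def gcost (S : STree T) (f : ℕ → Fin M → ℝ) (c : ℕ → Fin M → Fin N → ℝ)
    (x : S.Node → Fin M → ℤ) (y : S.Node → Fin M → Fin N → ℝ) (n : S.Node) : ℝ :=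
  (∑ i, f (S.stage n) i * ∑ m ∈ S.path n, (x m i : ℝ)) + ∑ i, ∑ j, c (S.stage n) i j * y n i j

/-- Feasibility for the concrete capacity planning model on the scenario tree. -/
def CFeas (S : STree T) (h f : ℕ → Fin M → ℝ) (c : ℕ → Fin M → Fin N → ℝ)
    (d : S.Node → Fin N → ℝ)
    (x : S.Node → Fin M → ℤ) (y : S.Node → Fin M → Fin N → ℝ) (η u : S.Node → ℝ) : Prop :=
  (∀ n i, 0 ≤ x n i) ∧ (∀ n i j, 0 ≤ y n i j) ∧ (∀ n, n ≠ S.root → 0 ≤ u n) ∧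
  (∀ n j, ∑ i, y n i j = d n j) ∧
  (∀ n i, ∑ j, y n i j ≤ h (S.stage n) i * ∑ m ∈ S.path n, (x m i : ℝ)) ∧
  ∀ n, n ≠ S.root → gcost S f c x y n ≤ u n + η (S.parent n)

/-- The risk-averse objective of the concrete capacity planning model. -/
noncomputable def CF (S : STree T) (p : S.Node → ℝ) (f : ℕ → Fin M → ℝ)
    (c : ℕ → Fin M → Fin N → ℝ) (lam alpha : ℕ → ℝ)
    (x : S.Node → Fin M → ℤ) (y : S.Node → Fin M → Fin N → ℝ) (η u : S.Node → ℝ) : ℝ :=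
  ∑ n, p n *
    ((∑ i, (if n = S.root then f 1 i else (1 - lam (S.stage n)) * f (S.stage n) i)
        * ∑ m ∈ S.path n, (x m i : ℝ))
     + (∑ i, ∑ j, (if n = S.root then c 1 i j
                   else (1 - lam (S.stage n)) * c (S.stage n) i j) * y n i j)
     + (if S.stage n = T then 0 else lam (S.stage n + 1)) * η n
     + (if n = S.root then 0 else lam (S.stage n) / (1 - alpha (S.stage n))) * u n)

/-- The analytic lower bound
`⌈D₁/h_max⌉ · ∑ₛ minᵢ f_{s,i} + ∑ₛ (min_{i,j} c_{s,ij}) · min_{n∈𝒯ₛ} ∑ⱼ d_{n,j}`. -/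
noncomputable def lbound [NeZero M] [NeZero N] (S : STree T) (h f : ℕ → Fin M → ℝ)
    (c : ℕ → Fin M → Fin N → ℝ) (d : S.Node → Fin N → ℝ) : ℝ :=
  (⌈(∑ j, d S.root j) / (Finset.univ.sup' Finset.univ_nonempty (h 1))⌉ : ℝ)
      * (∑ s ∈ Finset.Icc 1 T, Finset.univ.inf' Finset.univ_nonempty (f s))
    + ∑ s ∈ (Finset.Icc 1 T).attach,
        (Finset.univ.inf' Finset.univ_nonempty (fun ij : Fin M × Fin N => c s.1 ij.1 ij.2))
          * ((S.stageNodes s.1).inf'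
              (S.stageNodes_nonempty s.1 (Finset.mem_Icc.mp s.2).1 (Finset.mem_Icc.mp s.2).2)
              (fun n => ∑ j, d n j))

end ConcreteModel

namespace STree

variable {T : ℕ} (S : STree T)

theorem eq_root_of_stage_eq_one {n : S.Node} (hn : S.stage n = 1) : n = S.root := by
  by_contra hr
  have h1 := S.stage_parent n hr
  have h2 := S.stage_ge (S.parent n)
  omega

theorem iterate_parent_stage (k : ℕ) :
    ∀ n, S.stage n = k + 1 → S.parent^[k] n = S.root := by
  induction k with
  | zero => exact fun n hn => S.eq_root_of_stage_eq_one hn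
  | succ k ih =>
    intro n hn
    have hr : n ≠ S.root := by
      rintro rfl
      have := S.stage_root
      omega
    rw [Function.iterate_succ_apply]
    exact ih _ (by rw [S.stage_parent n hr]; omega)

theorem root_mem_path (n : S.Node) : S.root ∈ S.path n := by
  have h1 := S.stage_ge n
  have h2 := S.stage_le n
  exact Finset.mem_image.mpr ⟨S.stage n - 1, Finset.mem_range.mpr (by omega),
    S.iterate_parent_stage _ n (by omega)⟩

theorem path_root : S.path S.root = {S.root} := by
  refine Finset.eq_singleton_iff_unique_mem.mpr ⟨S.root_mem_path _, fun m hm => ?_⟩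
  obtain ⟨k, -, rfl⟩ := Finset.mem_image.mp hm
  exact Function.iterate_fixed S.parent_root k

theorem stage_of_mem_children {n m : S.Node} (hm : m ∈ S.children n) :
    S.stage m = S.stage n + 1 := by
  obtain ⟨-, h1, rfl⟩ := Finset.mem_filter.mp hm
  have h2 := S.stage_parent m h1
  have h3 := S.stage_ge (S.parent m)
  omega

theorem two_le_stage {n : S.Node} (hn : n ≠ S.root) : 2 ≤ S.stage n := by
  have h1 := S.stage_ge n
  have h2 : S.stage n ≠ 1 := fun h => hn (S.eq_root_of_stage_eq_one h)
  omega

theorem sum_children (ψ : S.Node → ℝ) :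
    ∑ n, ∑ m ∈ S.children n, ψ m = ∑ n, if n = S.root then 0 else ψ n := by
  have h1 : ∀ n, S.children n
      = (Finset.univ.filter fun m => m ≠ S.root).filter fun m => S.parent m = n := by
    intro n
    rw [Finset.filter_filter]
    rfl
  simp_rw [h1]
  rw [Finset.sum_fiberwise, Finset.sum_filter]
  exact Finset.sum_congr rfl fun n _ => by by_cases hn : n = S.root <;> simp [hn]

theorem sum_stageNodes (ψ : S.Node → ℝ) :
    ∑ s ∈ Finset.Icc 1 T, ∑ n ∈ S.stageNodes s, ψ n = ∑ n, ψ n :=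
  Finset.sum_fiberwise_of_maps_to
    (fun n _ => Finset.mem_Icc.mpr ⟨S.stage_ge n, S.stage_le n⟩) ψ

/-- Weighting the parent's value by the node probability is weighting each non-leaf value
by its own probability. -/
theorem sum_parent_eq {p : S.Node → ℝ}
    (hpc : ∀ n, S.stage n ≠ T → ∑ m ∈ S.children n, p m = p n) (lam : ℕ → ℝ)
    (η : S.Node → ℝ) :
    ∑ n, p n * ((if S.stage n = T then 0 else lam (S.stage n + 1)) * η n)
      = ∑ n, if n = S.root then 0 else p n * (lam (S.stage n) * η (S.parent n)) := by
  rw [← S.sum_children]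
  refine Finset.sum_congr rfl fun n _ => ?_
  have key : ∑ m ∈ S.children n, p m * (lam (S.stage m) * η (S.parent m))
      = (∑ m ∈ S.children n, p m) * (lam (S.stage n + 1) * η n) := by
    rw [Finset.sum_mul]
    refine Finset.sum_congr rfl fun m hm => ?_
    rw [S.stage_of_mem_children hm, (Finset.mem_filter.mp hm).2.2]
  rw [key]
  by_cases hT : S.stage n = T
  · have : S.children n = ∅ := by
      refine Finset.eq_empty_of_forall_notMem fun m hm => ?_
      have h1 := S.stage_of_mem_children hm
      have h2 := S.stage_le m
      omega
    simp [hT, this]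
  · rw [hpc n hT, if_neg hT]

end STree

section LowerBound

variable {T M N : ℕ} {S : STree T} {p : S.Node → ℝ} {h f : ℕ → Fin M → ℝ}
  {c : ℕ → Fin M → Fin N → ℝ} {d : S.Node → Fin N → ℝ} {lam alpha : ℕ → ℝ}
  {x : S.Node → Fin M → ℤ} {y : S.Node → Fin M → Fin N → ℝ} {η u : S.Node → ℝ}

/-- The risk-averse objective dominates the expected total cost. -/
theorem CFeas.sum_gcost_le_CF (hF : CFeas S h f c d x y η u) (hp : ∀ n, 0 ≤ p n)
    (hpc : ∀ n, S.stage n ≠ T → ∑ m ∈ S.children n, p m = p n)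
    (hlam : ∀ s, 2 ≤ s → s ≤ T → 0 ≤ lam s ∧ lam s ≤ 1)
    (halpha : ∀ s, 2 ≤ s → s ≤ T → 0 ≤ alpha s ∧ alpha s < 1) :
    ∑ n, p n * gcost S f c x y n ≤ CF S p f c lam alpha x y η u := by
  obtain ⟨-, -, hu, -, -, hg⟩ := hF
  have split : CF S p f c lam alpha x y η u =
      ∑ n, (p n * ((if n = S.root then 1 else 1 - lam (S.stage n)) * gcost S f c x y n
        + (if n = S.root then 0 else lam (S.stage n) / (1 - alpha (S.stage n))) * u n)
        + if n = S.root then 0 else p n * (lam (S.stage n) * η (S.parent n))) := by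
    rw [Finset.sum_add_distrib, ← S.sum_parent_eq hpc, ← Finset.sum_add_distrib]
    refine Finset.sum_congr rfl fun n _ => ?_
    by_cases hn : n = S.root
    · subst hn
      simp only [gcost, S.stage_root, if_true]
      ring
    · simp only [gcost, if_neg hn, mul_add, Finset.mul_sum]
      simp only [mul_assoc]
      ring
  rw [split]
  refine Finset.sum_le_sum fun n _ => ?_
  by_cases hn : n = S.root
  · simp [hn]
  · simp only [if_neg hn]
    rw [← mul_add]
    refine mul_le_mul_of_nonneg_left ?_ (hp n)
    obtain ⟨l0, -⟩ := hlam _ (S.two_le_stage hn) (S.stage_le n)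
    obtain ⟨a0, a1⟩ := halpha _ (S.two_le_stage hn) (S.stage_le n)
    have h1 : lam (S.stage n) ≤ lam (S.stage n) / (1 - alpha (S.stage n)) :=
      le_div_self l0 (by linarith) (by linarith)
    have h2 := mul_le_mul_of_nonneg_right h1 (hu n hn)
    have h3 := mul_le_mul_of_nonneg_left (hg n hn) l0
    linarith

variable [NeZero M]

/-- Serving the root demand requires `⌈D₁/h_max⌉` installed units. -/
theorem CFeas.ceil_le_sum_path (hF : CFeas S h f c d x y η u) (hh : ∀ i, 0 < h 1 i)
    (n : S.Node) :
    (⌈(∑ j, d S.root j) / (Finset.univ.sup' Finset.univ_nonempty (h 1))⌉ : ℝ)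
      ≤ ∑ i, ∑ m ∈ S.path n, (x m i : ℝ) := by
  obtain ⟨hx, -, -, hd, hcap, -⟩ := hF
  have hpos : 0 < Finset.univ.sup' Finset.univ_nonempty (h 1) :=
    (hh 0).trans_le (Finset.le_sup' (h 1) (Finset.mem_univ 0))
  have hroot : (⌈(∑ j, d S.root j) / (Finset.univ.sup' Finset.univ_nonempty (h 1))⌉ : ℝ)
      ≤ ((∑ i, x S.root i : ℤ) : ℝ) := by
    refine Int.cast_le.mpr (Int.ceil_le.mpr ?_)
    rw [div_le_iff₀ hpos]
    calc ∑ j, d S.root j = ∑ i, ∑ j, y S.root i j := by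
          rw [Finset.sum_comm]
          exact Finset.sum_congr rfl fun j _ => (hd _ j).symm
      _ ≤ ∑ i, (x S.root i : ℝ) * Finset.univ.sup' Finset.univ_nonempty (h 1) := by
          refine Finset.sum_le_sum fun i _ => (hcap S.root i).trans ?_
          rw [S.path_root, S.stage_root, Finset.sum_singleton, mul_comm]
          exact mul_le_mul_of_nonneg_left (Finset.le_sup' (h 1) (Finset.mem_univ i))
            (Int.cast_nonneg (hx _ i))
      _ = _ := by rw [← Finset.sum_mul]; push_cast; rfl
  refine hroot.trans ?_
  push_cast
  exact Finset.sum_le_sum fun i _ => Finset.single_le_sum (f := fun m => (x m i : ℝ))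
    (fun m _ => Int.cast_nonneg (hx m i)) (S.root_mem_path n)

variable [NeZero N]

theorem CFeas.le_gcost (hF : CFeas S h f c d x y η u) (hh : ∀ i, 0 < h 1 i)
    (n : S.Node) (hf : ∀ i, 0 < f (S.stage n) i) :
    (⌈(∑ j, d S.root j) / (Finset.univ.sup' Finset.univ_nonempty (h 1))⌉ : ℝ)
        * Finset.univ.inf' Finset.univ_nonempty (f (S.stage n))
      + (Finset.univ.inf' Finset.univ_nonempty
          (fun ij : Fin M × Fin N => c (S.stage n) ij.1 ij.2)) * ∑ j, d n j
      ≤ gcost S f c x y n := by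
  have hceil := hF.ceil_le_sum_path hh n
  obtain ⟨hx, hy, -, hd, -, -⟩ := hF
  have hfmin : 0 ≤ Finset.univ.inf' Finset.univ_nonempty (f (S.stage n)) :=
    Finset.le_inf' _ _ fun i _ => (hf i).le
  refine add_le_add ((mul_le_mul_of_nonneg_right hceil hfmin).trans ?_) ?_
  · rw [Finset.sum_mul]
    refine Finset.sum_le_sum fun i _ => ?_
    rw [mul_comm]
    exact mul_le_mul_of_nonneg_right (Finset.inf'_le _ (Finset.mem_univ i))
      (Finset.sum_nonneg fun m _ => Int.cast_nonneg (hx m i))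
  · simp_rw [← hd n]
    rw [Finset.sum_comm, Finset.mul_sum]
    refine Finset.sum_le_sum fun i _ => ?_
    rw [Finset.mul_sum]
    exact Finset.sum_le_sum fun j _ => mul_le_mul_of_nonneg_right
      (Finset.inf'_le (fun ij : Fin M × Fin N => c (S.stage n) ij.1 ij.2)
        (Finset.mem_univ (i, j))) (hy n i j)

theorem CFeas.lbound_le_CF (hF : CFeas S h f c d x y η u) (hp : ∀ n, 0 ≤ p n)
    (hp1 : ∀ s, 1 ≤ s → s ≤ T → ∑ n ∈ S.stageNodes s, p n = 1)
    (hpc : ∀ n, S.stage n ≠ T → ∑ m ∈ S.children n, p m = p n)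
    (hh : ∀ i, 0 < h 1 i)
    (hfpos : ∀ s, 1 ≤ s → s ≤ T → ∀ i, 0 < f s i)
    (hc : ∀ s, 1 ≤ s → s ≤ T → ∀ i j, 0 ≤ c s i j)
    (hlam : ∀ s, 2 ≤ s → s ≤ T → 0 ≤ lam s ∧ lam s ≤ 1)
    (halpha : ∀ s, 2 ≤ s → s ≤ T → 0 ≤ alpha s ∧ alpha s < 1) :
    lbound S h f c d ≤ CF S p f c lam alpha x y η u := by
  refine le_trans ?_ (hF.sum_gcost_le_CF hp hpc hlam halpha)
  rw [← S.sum_stageNodes, lbound, Finset.mul_sum, ← Finset.sum_attach (Finset.Icc 1 T),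
    ← Finset.sum_add_distrib, ← Finset.sum_attach (Finset.Icc 1 T)]
  refine Finset.sum_le_sum fun ⟨s, hs⟩ _ => ?_
  obtain ⟨hs1, hsT⟩ := Finset.mem_Icc.mp hs
  rw [← one_mul (_ + _), ← hp1 s hs1 hsT, Finset.sum_mul]
  refine Finset.sum_le_sum fun n hn => mul_le_mul_of_nonneg_left ?_ (hp n)
  have hns : S.stage n = s := (Finset.mem_filter.mp hn).2
  have hle := hF.le_gcost hh n (hfpos _ (S.stage_ge n) (S.stage_le n))
  rw [hns] at hle
  refine le_trans (add_le_add le_rfl (mul_le_mul_of_nonneg_left ?_ ?_)) hle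
  · exact Finset.inf'_le (fun n => ∑ j, d n j) hn
  · exact Finset.le_inf' _ _ fun ij _ => hc s hs1 hsT ij.1 ij.2

theorem lbound_pos (hh : ∀ i, 0 < h 1 i)
    (hfpos : ∀ s, 1 ≤ s → s ≤ T → ∀ i, 0 < f s i)
    (hc : ∀ s, 1 ≤ s → s ≤ T → ∀ i j, 0 ≤ c s i j)
    (hd : ∀ n j, 0 ≤ d n j) (hD1 : 0 < ∑ j, d S.root j) :
    0 < lbound S h f c d := by
  have hpos : 0 < Finset.univ.sup' Finset.univ_nonempty (h 1) :=
    (hh 0).trans_le (Finset.le_sup' (h 1) (Finset.mem_univ 0))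
  refine add_pos_of_pos_of_nonneg (mul_pos ?_ ?_) ?_
  · exact Int.cast_pos.mpr (Int.ceil_pos.mpr (div_pos hD1 hpos))
  · refine Finset.sum_pos (fun s hs => ?_) (Finset.nonempty_Icc.mpr S.hT)
    obtain ⟨hs1, hsT⟩ := Finset.mem_Icc.mp hs
    exact (Finset.lt_inf'_iff _).mpr fun i _ => hfpos s hs1 hsT i
  · refine Finset.sum_nonneg fun ⟨s, hs⟩ _ => ?_
    obtain ⟨hs1, hsT⟩ := Finset.mem_Icc.mp hs
    exact mul_nonneg (Finset.le_inf' _ _ fun ij _ => hc s hs1 hsT ij.1 ij.2)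
      (Finset.le_inf' _ _ fun n _ => Finset.sum_nonneg fun j _ => hd n j)

end LowerBound

/-- Theorem 4: approximation ratio: any feasible tuple whose
objective value `v` satisfies `v - z^MS ≤ ∑ₛ∑ᵢ f_{s,i}` has
`v / z^MS ≤ 1 + M ∑ₛ maxᵢ f_{s,i} / (⌈D₁/h_max⌉ ∑ₛ minᵢ f_{s,i}
  + ∑ₛ (min_{i,j} c_{s,ij}) min_{n∈𝒯ₛ} ∑ⱼ d_{n,j})`. -/
theorem approximation_ratio {T M N : ℕ} [NeZero M] [NeZero N] (S : STree T)
    (p : S.Node → ℝ) (h f : ℕ → Fin M → ℝ) (c : ℕ → Fin M → Fin N → ℝ)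
    (d : S.Node → Fin N → ℝ) (lam alpha : ℕ → ℝ)
    (hp : ∀ n, 0 ≤ p n)
    (hp1 : ∀ s, 1 ≤ s → s ≤ T → ∑ n ∈ S.stageNodes s, p n = 1)
    (hpc : ∀ n, S.stage n ≠ T → ∑ m ∈ S.children n, p m = p n)
    (hh : ∀ s, 1 ≤ s → s ≤ T → ∀ i, 0 < h s i)
    (hfpos : ∀ s, 1 ≤ s → s ≤ T → ∀ i, 0 < f s i)
    (hc : ∀ s, 1 ≤ s → s ≤ T → ∀ i j, 0 ≤ c s i j)
    (hd : ∀ n j, 0 ≤ d n j)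
    (hD1 : 0 < ∑ j, d S.root j)
    (hlam : ∀ s, 2 ≤ s → s ≤ T → 0 ≤ lam s ∧ lam s ≤ 1)
    (halpha : ∀ s, 2 ≤ s → s ≤ T → 0 ≤ alpha s ∧ alpha s < 1)
    (hne : ∃ x y η u, CFeas S h f c d x y η u) :
    ∀ x y η u, CFeas S h f c d x y η u →
      CF S p f c lam alpha x y η u
          - sInf {v : ℝ | ∃ x y η u, CFeas S h f c d x y η u ∧
              v = CF S p f c lam alpha x y η u}
        ≤ ∑ s ∈ Finset.Icc 1 T, ∑ i, f s i →
      CF S p f c lam alpha x y η u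
          / sInf {v : ℝ | ∃ x y η u, CFeas S h f c d x y η u ∧
              v = CF S p f c lam alpha x y η u}
        ≤ 1 + ((M : ℝ) * ∑ s ∈ Finset.Icc 1 T, Finset.univ.sup' Finset.univ_nonempty (f s))
            / lbound S h f c d := by
  intro x y η u hF hv
  set z := sInf {v : ℝ | ∃ x y η u, CFeas S h f c d x y η u ∧
    v = CF S p f c lam alpha x y η u}
  have hh1 := hh 1 le_rfl S.hT
  have hL : 0 < lbound S h f c d := lbound_pos hh1 hfpos hc hd hD1
  have hLz : lbound S h f c d ≤ z := by
    refine le_csInf ⟨_, x, y, η, u, hF, rfl⟩ ?_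
    rintro _ ⟨x', y', η', u', hF', rfl⟩
    exact hF'.lbound_le_CF hp hp1 hpc hh1 hfpos hc hlam halpha
  have hzpos : 0 < z := hL.trans_le hLz
  have hB : ∑ s ∈ Finset.Icc 1 T, ∑ i, f s i
      ≤ (M : ℝ) * ∑ s ∈ Finset.Icc 1 T, Finset.univ.sup' Finset.univ_nonempty (f s) := by
    rw [Finset.mul_sum]
    refine Finset.sum_le_sum fun s _ => ?_
    have := Finset.sum_le_card_nsmul Finset.univ (f s)
      (Finset.univ.sup' Finset.univ_nonempty (f s))
      fun i hi => Finset.le_sup' (f s) hi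
    simpa using this
  have hB0 : 0 ≤ ∑ s ∈ Finset.Icc 1 T, ∑ i, f s i := by
    refine Finset.sum_nonneg fun s hs => Finset.sum_nonneg fun i _ => ?_
    obtain ⟨hs1, hsT⟩ := Finset.mem_Icc.mp hs
    exact (hfpos s hs1 hsT i).le
  calc CF S p f c lam alpha x y η u / z
      = 1 + (CF S p f c lam alpha x y η u - z) / z := by field_simp; ring
    _ ≤ _ := add_le_add le_rfl (div_le_div₀ (hB0.trans hB) (hv.trans hB) hL hLz)
end

section
/- (Theorem A.1: time consistency of expected conditional risk measures.) Let 𝒯 be a scenario tree with T stages and strictly positive node probabilities p (p_n > 0, with ∑_{m∈𝒞(n)} p_m = p_n for every n ∉ ℒ). For s = 2,…,T let ρ_s : Z_s → Z_{s−1} be any monotone map with respect to the pointwise orders (as holds for coherent conditional risk measures). Then the expected conditional risk measure {𝔽_{l,T}}_{l=1}^T built from the ρ_s is time consistent: for all 1 ≤ l < k ≤ T and all g_i, w_i ∈ Z_i (i = l,…,T), if g_i = w_i for every i = l,…,k−1 and 𝔽_{k,T}(g_k,…,g_T) ≤ 𝔽_{k,T}(w_k,…,w_T) pointwise on 𝒯_k,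 then 𝔽_{l,T}(g_l,…,g_T) ≤ 𝔽_{l,T}(w_l,…,w_T) pointwise on 𝒯_l. -/
open Finset

section ECRM

variable {T : ℕ}

/-- `σ_s = ι_{s-1} ∘ E_{s-2} ∘ ρ_s` for `s ≥ 3`, and `σ_2 = ρ_2`, where
`E` is conditional expectation with weights `p_m / p_n` and `ι` the lift
`(ι W)(n) = W(a(n))`.  Stage-`s` functions are encoded as functions on all
nodes, used only on the stage-`s` nodes. -/
noncomputable def sigmaECRM (S : STree T) (p : S.Node → ℝ)
    (rho : ℕ → (S.Node → ℝ) → (S.Node → ℝ)) (s : ℕ)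
    (g : S.Node → ℝ) (n : S.Node) : ℝ :=
  if s = 2 then rho 2 g n
  else ∑ m ∈ S.children (S.parent n), (p m / p (S.parent n)) * rho s g m

/-- Recursion underlying the expected conditional risk measure, with explicit
fuel `k` (the number of remaining stages). -/
noncomputable def FFaux (S : STree T) (p : S.Node → ℝ)
    (rho : ℕ → (S.Node → ℝ) → (S.Node → ℝ)) (g : ℕ → S.Node → ℝ) :
    ℕ → ℕ → S.Node → ℝ
  | 0, l => g l
  | k + 1, l => fun n => g l n + sigmaECRM S p rho (l + 1) (FFaux S p rho g k (l + 1)) n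

/-- The expected conditional risk measure `𝔽_{l,T}`:
`𝔽_{T,T}(g_T) = g_T` and `𝔽_{l,T}(g_l,…,g_T) = g_l + σ_{l+1}(𝔽_{l+1,T}(g_{l+1},…,g_T))`. -/
noncomputable def FF (S : STree T) (p : S.Node → ℝ)
    (rho : ℕ → (S.Node → ℝ) → (S.Node → ℝ)) (g : ℕ → S.Node → ℝ) (l : ℕ) :
    S.Node → ℝ :=
  FFaux S p rho g (T - l) l

end ECRM

theorem STree.stage_eq_of_mem_children_parent {T : ℕ} (S : STree T) {m n : S.Node}
    (hn : 2 ≤ S.stage n) (hm : m ∈ S.children (S.parent n)) : S.stage m = S.stage n := by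
  obtain ⟨hm_root, hmn⟩ := (Finset.mem_filter.mp hm).2
  have hn_root : n ≠ S.root := by
    rintro rfl
    have := S.stage_root
    omega
  have h₁ := S.stage_parent m hm_root
  have h₂ := S.stage_parent n hn_root
  rw [hmn] at h₁
  omega

theorem sigmaECRM_mono {T : ℕ} (S : STree T) {p : S.Node → ℝ} (hp : ∀ n, 0 ≤ p n)
    {rho : ℕ → (S.Node → ℝ) → (S.Node → ℝ)} {s : ℕ} (hs : 2 ≤ s) {g w : S.Node → ℝ}
    (hrho : ∀ n, S.stage n = s - 1 → rho s g n ≤ rho s w n)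
    {n : S.Node} (hn : S.stage n = s - 1) :
    sigmaECRM S p rho s g n ≤ sigmaECRM S p rho s w n := by
  unfold sigmaECRM
  split_ifs with h
  · subst h
    exact hrho n hn
  · refine Finset.sum_le_sum fun m hm => mul_le_mul_of_nonneg_left (hrho m ?_)
      (div_nonneg (hp _) (hp _))
    rw [S.stage_eq_of_mem_children_parent (by omega) hm, hn]

theorem FF_of_lt {T : ℕ} (S : STree T) (p : S.Node → ℝ)
    (rho : ℕ → (S.Node → ℝ) → (S.Node → ℝ)) (g : ℕ → S.Node → ℝ) {l : ℕ} (hl : l < T)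
    (n : S.Node) :
    FF S p rho g l n = g l n + sigmaECRM S p rho (l + 1) (FF S p rho g (l + 1)) n := by
  have h : T - l = (T - (l + 1)) + 1 := by omega
  rw [FF, h]
  rfl

/-- Theorem A.1: expected conditional risk measures built from
monotone one-step conditional risk measures are time consistent. -/
theorem ecrm_time_consistent {T : ℕ} (S : STree T) (p : S.Node → ℝ)
    (hp : ∀ n, 0 < p n)
    (hpc : ∀ n, S.stage n ≠ T → ∑ m ∈ S.children n, p m = p n)
    (rho : ℕ → (S.Node → ℝ) → (S.Node → ℝ))
    (hmono : ∀ s, 2 ≤ s → s ≤ T → ∀ g w : S.Node → ℝ,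
      (∀ n, S.stage n = s → g n ≤ w n) →
      ∀ n, S.stage n = s - 1 → rho s g n ≤ rho s w n)
    (l k : ℕ) (hl : 1 ≤ l) (hlk : l < k) (hk : k ≤ T)
    (g w : ℕ → S.Node → ℝ)
    (heq : ∀ i, l ≤ i → i < k → ∀ n, S.stage n = i → g i n = w i n)
    (hmain : ∀ n, S.stage n = k → FF S p rho g k n ≤ FF S p rho w k n) :
    ∀ n, S.stage n = l → FF S p rho g l n ≤ FF S p rho w l n := by
  have step : ∀ j, 1 ≤ j → l ≤ j → j ≤ k →
      ∀ n, S.stage n = j → FF S p rho g j n ≤ FF S p rho w j n := by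
    intro j hj hlj hjk
    induction hjk using Nat.decreasingInduction with
    | self => exact hmain
    | of_succ j hjk ih =>
      intro n hn
      rw [FF_of_lt S p rho g (by omega), FF_of_lt S p rho w (by omega), heq j hlj hjk n hn]
      exact add_le_add_right (sigmaECRM_mono S (fun n => (hp n).le) (by omega)
        (hmono (j + 1) (by omega) (by omega) _ _ (ih (by omega) (by omega))) hn) _
  exact step l hl le_rfl hlk.le
end
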